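/- arXiv:2210.04804 — 2 statements merged into one kernel-verified Lean document; each statement's English description precedes it below -/
import Mathlib

section
/- Let (A_n)_{n∈ℕ} be a sequence of invertible linear operators on ℝ^d. Then the following are equivalent: (1) (A_n)_{n∈ℕ} admits a nonuniform strong polynomial dichotomy; (2) there exists a sequence of norms (‖·‖_n)_{n∈ℕ} on ℝ^d such that (A_n)_{n∈ℕ} admits a strong polynomial dichotomy with respect to (‖·‖_n)_{n∈ℕ}, and there exist constants C>0 and δ≥0 such that ‖x‖ ≤ ‖x‖_n ≤ C·n^δ·‖x‖ for every x∈ℝ^d and n∈ℕ. -/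
noncomputable section

namespace NonautLin

variable {E : Type*} [NormedAddCommGroup E] [NormedSpace ℝ E]

/-- `N : E → ℝ` is a norm on the real vector space `E`. -/
def IsNormOn (N : E → ℝ) : Prop :=
  (∀ x, 0 ≤ N x) ∧ (∀ x, N x = 0 ↔ x = 0) ∧
  (∀ (c : ℝ) (x : E), N (c • x) = |c| * N x) ∧
  (∀ x y : E, N (x + y) ≤ N x + N y)

/-- `fwd A n k` is the composition `A (n+k-1) ∘ ⋯ ∘ A n`. -/
def fwd (A : ℕ → (E ≃L[ℝ] E)) (n : ℕ) : ℕ → (E ≃L[ℝ] E)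
  | 0 => ContinuousLinearEquiv.refl ℝ E
  | k + 1 => (fwd A n k).trans (A (n + k))

/-- The cocycle `𝒜(m,n)` associated with the one-sided sequence `A`:
`𝒜(m,n) = A (m-1) ∘ ⋯ ∘ A n` for `m > n`, `𝒜(n,n) = Id`, and
`𝒜(m,n) = (𝒜(n,m))⁻¹` for `m < n`. -/
def coc (A : ℕ → (E ≃L[ℝ] E)) (m n : ℕ) : E ≃L[ℝ] E :=
  if n ≤ m then fwd A n (m - n) else (fwd A m (n - m)).symm

/-- Nonuniform strong polynomial dichotomy (indices `n ≥ 1`), with nonuniformity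
exponent `eps`. -/
def NonuniformStrongPolyDichotomyWith (A : ℕ → (E ≃L[ℝ] E)) (eps : ℝ) : Prop :=
  ∃ K lam a : ℝ, 0 < K ∧ 0 < lam ∧ lam ≤ a ∧
    ∃ P : ℕ → (E →L[ℝ] E),
      (∀ n, 1 ≤ n → (P n).comp (P n) = P n) ∧
      (∀ n, 1 ≤ n → ((A n : E →L[ℝ] E)).comp (P n) = (P (n + 1)).comp (A n : E →L[ℝ] E)) ∧
      (∀ m n : ℕ, 1 ≤ n → n ≤ m →
        ‖((coc A m n : E →L[ℝ] E)).comp (P n)‖ ≤ K * ((m : ℝ) / n) ^ (-lam) * (n : ℝ) ^ eps ∧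
        ‖((coc A n m : E →L[ℝ] E)).comp (ContinuousLinearMap.id ℝ E - P m)‖
          ≤ K * ((m : ℝ) / n) ^ (-lam) * (m : ℝ) ^ eps ∧
        ‖(coc A m n : E →L[ℝ] E)‖ ≤ K * ((m : ℝ) / n) ^ a * (n : ℝ) ^ eps ∧
        ‖(coc A n m : E →L[ℝ] E)‖ ≤ K * ((m : ℝ) / n) ^ a * (m : ℝ) ^ eps)

/-- Nonuniform strong polynomial dichotomy (indices `n ≥ 1`). -/
def NonuniformStrongPolyDichotomy (A : ℕ → (E ≃L[ℝ] E)) : Prop :=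
  ∃ eps : ℝ, 0 ≤ eps ∧ NonuniformStrongPolyDichotomyWith A eps

/-- Strong polynomial dichotomy with respect to a sequence of norms (indices `n ≥ 1`). -/
def StrongPolyDichotomyWRT (A : ℕ → (E ≃L[ℝ] E)) (N : ℕ → E → ℝ) : Prop :=
  ∃ K lam a : ℝ, 0 < K ∧ 0 < lam ∧ lam ≤ a ∧
    ∃ P : ℕ → (E →L[ℝ] E),
      (∀ n, 1 ≤ n → (P n).comp (P n) = P n) ∧
      (∀ n, 1 ≤ n → ((A n : E →L[ℝ] E)).comp (P n) = (P (n + 1)).comp (A n : E →L[ℝ] E)) ∧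
      (∀ m n : ℕ, 1 ≤ n → n ≤ m → ∀ x : E,
        N m (coc A m n (P n x)) ≤ K * ((m : ℝ) / n) ^ (-lam) * N n x ∧
        N n (coc A n m (x - P m x)) ≤ K * ((m : ℝ) / n) ^ (-lam) * N m x ∧
        N m (coc A m n x) ≤ K * ((m : ℝ) / n) ^ a * N n x ∧
        N n (coc A n m x) ≤ K * ((m : ℝ) / n) ^ a * N m x)
/-! ### The cocycle -/

theorem fwd_add (A : ℕ → (E ≃L[ℝ] E)) (n k : ℕ) (x : E) :
    fwd A 0 (n + k) x = fwd A n k (fwd A 0 n x) := by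
  induction k with
  | zero => simp [fwd]
  | succ k ih => simp [← add_assoc, fwd, ih]

theorem coc_eq (A : ℕ → (E ≃L[ℝ] E)) (m n : ℕ) :
    coc A m n = (fwd A 0 n).symm.trans (fwd A 0 m) := by
  have key : ∀ {m n : ℕ}, n ≤ m → fwd A n (m - n) = (fwd A 0 n).symm.trans (fwd A 0 m) := by
    intro m n h
    ext x
    obtain ⟨k, rfl⟩ := Nat.exists_eq_add_of_le h
    simp [fwd_add]
  unfold coc
  split_ifs with h
  · exact key h
  · rw [key (Nat.le_of_not_le h)]
    rfl

theorem coc_self_apply (A : ℕ → (E ≃L[ℝ] E)) (n : ℕ) (x : E) : coc A n n x = x := by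
  simp [coc_eq]

theorem coc_coc_apply (A : ℕ → (E ≃L[ℝ] E)) (m k n : ℕ) (x : E) :
    coc A m k (coc A k n x) = coc A m n x := by
  simp [coc_eq]

theorem coc_succ_apply (A : ℕ → (E ≃L[ℝ] E)) (m n : ℕ) (x : E) :
    coc A (m + 1) n x = A m (coc A m n x) := by
  simp [coc_eq, fwd]

/-- A sequence of operators commuting with each step commutes with the whole cocycle. -/
theorem coc_comm {A : ℕ → (E ≃L[ℝ] E)} {P : ℕ → (E →L[ℝ] E)}
    (hP : ∀ n, 1 ≤ n → (A n : E →L[ℝ] E).comp (P n) = (P (n + 1)).comp (A n : E →L[ℝ] E))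
    {m n : ℕ} (hm : 1 ≤ m) (hn : 1 ≤ n) (x : E) :
    P m (coc A m n x) = coc A m n (P n x) := by
  have forward : ∀ {m n : ℕ}, 1 ≤ n → n ≤ m → ∀ x, P m (coc A m n x) = coc A m n (P n x) := by
    intro m n hn hnm x
    induction m, hnm using Nat.le_induction with
    | base => simp only [coc_self_apply]
    | succ m hnm ih =>
      rw [coc_succ_apply, coc_succ_apply, ← ih]
      exact (DFunLike.congr_fun (hP m (hn.trans hnm)) _).symm
  rcases le_total n m with h | h
  · exact forward hn h x
  · apply (coc A n m).injective
    rw [← forward hm h, coc_coc_apply, coc_coc_apply, coc_self_apply, coc_self_apply]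

/-! ### Weighted suprema -/

/-- The supremum over `m` of the seminorms `w m * ‖T m x‖`. -/
def weightedSup (w : ℕ → ℝ) (T : ℕ → (E →L[ℝ] E)) (x : E) : ℝ :=
  ⨆ m, w m * ‖T m x‖

section weightedSup

variable {w : ℕ → ℝ} {T : ℕ → (E →L[ℝ] E)} {B : ℝ}

theorem weightedSup_nonneg (hw : ∀ m, 0 ≤ w m) (x : E) : 0 ≤ weightedSup w T x :=
  Real.iSup_nonneg fun m => mul_nonneg (hw m) (norm_nonneg _)

theorem weightedSup_le (hB : ∀ m x, w m * ‖T m x‖ ≤ B * ‖x‖) (x : E) :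
    weightedSup w T x ≤ B * ‖x‖ :=
  ciSup_le fun m => hB m x

theorem le_weightedSup (hB : ∀ m x, w m * ‖T m x‖ ≤ B * ‖x‖) (m : ℕ) (x : E) :
    w m * ‖T m x‖ ≤ weightedSup w T x :=
  le_ciSup (f := fun m => w m * ‖T m x‖) ⟨B * ‖x‖, by rintro _ ⟨m, rfl⟩; exact hB m x⟩ m

theorem weightedSup_smul (c : ℝ) (x : E) :
    weightedSup w T (c • x) = |c| * weightedSup w T x := by
  unfold weightedSup
  rw [Real.mul_iSup_of_nonneg (abs_nonneg c)]
  congr 1 with m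
  rw [map_smul, norm_smul, Real.norm_eq_abs]
  ring

theorem weightedSup_add_le (hw : ∀ m, 0 ≤ w m) (hB : ∀ m x, w m * ‖T m x‖ ≤ B * ‖x‖) (x y : E) :
    weightedSup w T (x + y) ≤ weightedSup w T x + weightedSup w T y := by
  refine ciSup_le fun m => ?_
  calc w m * ‖T m (x + y)‖ ≤ w m * (‖T m x‖ + ‖T m y‖) := by
        rw [map_add]
        exact mul_le_mul_of_nonneg_left (norm_add_le _ _) (hw m)
    _ = w m * ‖T m x‖ + w m * ‖T m y‖ := mul_add _ _ _
    _ ≤ _ := add_le_add (le_weightedSup hB m x) (le_weightedSup hB m y)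

theorem weightedSup_eq_zero {x : E} (h : ∀ m, T m x = 0) : weightedSup w T x = 0 := by
  simp [weightedSup, h]

theorem weightedSup_le_mul {w' : ℕ → ℝ} {T' : ℕ → (E →L[ℝ] E)} {c : ℝ} {x y : E} (hc : 0 ≤ c)
    (hB : ∀ m x, w m * ‖T m x‖ ≤ B * ‖x‖) (hw : ∀ m, w' m ≤ c * w m) (hT : ∀ m, T' m y = T m x) :
    weightedSup w' T' y ≤ c * weightedSup w T x := by
  refine ciSup_le fun m => ?_
  rw [hT m]
  calc w' m * ‖T m x‖ ≤ c * w m * ‖T m x‖ := mul_le_mul_of_nonneg_right (hw m) (norm_nonneg _)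
    _ = c * (w m * ‖T m x‖) := mul_assoc _ _ _
    _ ≤ _ := mul_le_mul_of_nonneg_left (le_weightedSup hB m x) hc

end weightedSup

/-! ### Polynomial weights -/

/-- The weight `min (r ^ lam) (r ^ a)`: for `lam ≤ a` it is `r ^ a` when `r ≤ 1` and `r ^ lam`
when `1 ≤ r`. -/
def polyWeight (lam a r : ℝ) : ℝ :=
  min (r ^ lam) (r ^ a)

theorem polyWeight_nonneg (lam a : ℝ) {r : ℝ} (hr : 0 ≤ r) : 0 ≤ polyWeight lam a r :=
  le_min (Real.rpow_nonneg hr _) (Real.rpow_nonneg hr _)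

theorem polyWeight_one (lam a : ℝ) : polyWeight lam a 1 = 1 := by
  simp [polyWeight]

theorem polyWeight_mul_le {lam a c t r : ℝ} (ht : 0 ≤ t) (hr : 0 ≤ r) (h1 : t ^ lam ≤ c)
    (h2 : t ^ a ≤ c) : polyWeight lam a (t * r) ≤ c * polyWeight lam a r := by
  have hc : 0 ≤ c := (Real.rpow_nonneg ht _).trans h1
  unfold polyWeight
  rw [mul_min_of_nonneg _ _ hc, Real.mul_rpow ht hr, Real.mul_rpow ht hr]
  exact min_le_min (mul_le_mul_of_nonneg_right h1 (Real.rpow_nonneg hr _))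
    (mul_le_mul_of_nonneg_right h2 (Real.rpow_nonneg hr _))

/-! ### Norms adapted to a dichotomy -/

/-- The seminorm at time `n` measuring the orbit of `R n x` in the weights `w`. -/
def orbitSup (A : ℕ → (E ≃L[ℝ] E)) (R : ℕ → (E →L[ℝ] E)) (w : ℕ → ℕ → ℝ) (n : ℕ) (x : E) : ℝ :=
  weightedSup (w n) (fun m => (coc A m n : E →L[ℝ] E).comp (R n)) x

theorem orbitSup_coc_le {A : ℕ → (E ≃L[ℝ] E)} {R : ℕ → (E →L[ℝ] E)} {w : ℕ → ℕ → ℝ}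
    {B c : ℝ} {k n : ℕ}
    (hR : ∀ x, R k (coc A k n x) = coc A k n (R n x)) (hc : 0 ≤ c)
    (hB : ∀ m x, w n m * ‖coc A m n (R n x)‖ ≤ B * ‖x‖) (hw : ∀ m, w k m ≤ c * w n m) (x : E) :
    orbitSup A R w k (coc A k n x) ≤ c * orbitSup A R w n x :=
  weightedSup_le_mul hc hB hw fun m => by simp [hR, coc_coc_apply]

theorem isNormOn_orbitSup_add {A : ℕ → (E ≃L[ℝ] E)} {P : ℕ → (E →L[ℝ] E)} {v w : ℕ → ℕ → ℝ}
    {B : ℝ} {n : ℕ} (hv : ∀ m, 0 ≤ v n m) (hw : ∀ m, 0 ≤ w n m)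
    (hvB : ∀ m x, v n m * ‖coc A m n (P n x)‖ ≤ B * ‖x‖)
    (hwB : ∀ m x, w n m * ‖coc A m n (x - P n x)‖ ≤ B * ‖x‖)
    (hle : ∀ x, ‖x‖ ≤ orbitSup A P v n x +
      orbitSup A (fun n => ContinuousLinearMap.id ℝ E - P n) w n x) :
    IsNormOn fun x => orbitSup A P v n x +
      orbitSup A (fun n => ContinuousLinearMap.id ℝ E - P n) w n x := by
  refine ⟨fun x => (norm_nonneg x).trans (hle x), fun x => ⟨fun h => ?_, ?_⟩, fun c x => ?_,
    fun x y => ?_⟩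
  · exact norm_le_zero_iff.1 (h ▸ hle x)
  · rintro rfl
    simp [orbitSup, weightedSup]
  · simp only [orbitSup, weightedSup_smul, mul_add]
  · have h1 := weightedSup_add_le (T := fun m => (coc A m n : E →L[ℝ] E).comp (P n)) hv hvB x y
    have h2 := weightedSup_add_le
      (T := fun m => (coc A m n : E →L[ℝ] E).comp (ContinuousLinearMap.id ℝ E - P n)) hw hwB x y
    simp only [orbitSup]
    linarith

theorem NonuniformStrongPolyDichotomy.exists_norms {A : ℕ → (E ≃L[ℝ] E)}
    (h : NonuniformStrongPolyDichotomy A) :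
    ∃ N : ℕ → E → ℝ,
      (∀ n : ℕ, 1 ≤ n → IsNormOn (N n)) ∧
      StrongPolyDichotomyWRT A N ∧
      ∃ C δ : ℝ, 0 < C ∧ 0 ≤ δ ∧
        ∀ (n : ℕ), 1 ≤ n → ∀ x : E, ‖x‖ ≤ N n x ∧ N n x ≤ C * (n : ℝ) ^ δ * ‖x‖ := by
  obtain ⟨eps, heps, K, lam, a, hK, hlam, hla, P, hPP, hAP, hD⟩ := h
  set Q : ℕ → (E →L[ℝ] E) := fun n => ContinuousLinearMap.id ℝ E - P n with hQ
  set v : ℕ → ℕ → ℝ := fun n m => polyWeight lam a ((m : ℝ) / n) with hv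
  set w : ℕ → ℕ → ℝ := fun n m => polyWeight lam a ((n : ℝ) / m) with hw
  set S := orbitSup A P v with hS
  set U := orbitSup A Q w with hU
  have hv0 : ∀ n m, 0 ≤ v n m := fun n m => polyWeight_nonneg _ _ (by positivity)
  have hw0 : ∀ n m, 0 ≤ w n m := fun n m => polyWeight_nonneg _ _ (by positivity)
  have hPc : ∀ {m n : ℕ}, 1 ≤ m → 1 ≤ n → ∀ x, P m (coc A m n x) = coc A m n (P n x) :=
    fun hm hn x => coc_comm hAP hm hn x
  have hQc : ∀ {m n : ℕ}, 1 ≤ m → 1 ≤ n → ∀ x, Q m (coc A m n x) = coc A m n (Q n x) := by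
    intro m n hm hn x
    simp [hQ, hPc hm hn]
  have hPi : ∀ {n : ℕ}, 1 ≤ n → ∀ x, P n (P n x) = P n x :=
    fun hn x => DFunLike.congr_fun (hPP _ hn) x
  set b : ℕ → ℝ := fun n => (K + K * K) * (n : ℝ) ^ (2 * eps) with hb
  -- Splitting the bound on a weighted orbit into the contracting and the growing direction.
  have bound : ∀ {n : ℕ} (R : E →L[ℝ] E) (y x : E) (T : E →L[ℝ] E) (r ω : ℝ), 1 ≤ n → 1 ≤ r →
      y = T (R x) → ‖R‖ ≤ K * (n : ℝ) ^ eps →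
      (ω ≤ r ^ lam ∧ ‖T.comp R‖ ≤ K * r ^ (-lam) * (n : ℝ) ^ eps ∨
        ω ≤ r ^ (-a) ∧ ‖T‖ ≤ K * r ^ a * (n : ℝ) ^ eps) → ω * ‖y‖ ≤ b n * ‖x‖ := by
    intro n R y x T r ω hn hr hy hR hcase
    have hn1 : (1 : ℝ) ≤ n := by exact_mod_cast hn
    have hr0 : 0 < r := by linarith
    have he1 : 1 ≤ (n : ℝ) ^ eps := Real.one_le_rpow hn1 heps
    have he2 : (n : ℝ) ^ (2 * eps) = (n : ℝ) ^ eps * (n : ℝ) ^ eps := by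
      rw [← Real.rpow_add (by linarith)]
      ring_nf
    have hx := norm_nonneg x
    set e := (n : ℝ) ^ eps
    have hbn : b n = K * (e * e) + K * e * (K * e) := by
      simp only [hb, he2]
      ring
    rcases hcase with ⟨h1, h2⟩ | ⟨h1, h2⟩
    · have hy' : ‖y‖ ≤ K * r ^ (-lam) * e * ‖x‖ := hy ▸ (T.comp R).le_of_opNorm_le h2 x
      calc ω * ‖y‖ ≤ r ^ lam * (K * r ^ (-lam) * e * ‖x‖) := by gcongr
        _ = (r ^ lam * r ^ (-lam)) * (K * e * ‖x‖) := by ring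
        _ = K * e * ‖x‖ := by rw [← Real.rpow_add hr0, add_neg_cancel, Real.rpow_zero, one_mul]
        _ ≤ b n * ‖x‖ := by
          gcongr
          rw [hbn]
          have : K * e ≤ K * (e * e) := by gcongr; nlinarith
          have : 0 ≤ K * e * (K * e) := mul_self_nonneg _
          linarith
    · have hy' : ‖y‖ ≤ K * r ^ a * e * (K * e * ‖x‖) := by
        rw [hy]
        exact (T.le_of_opNorm_le h2 _).trans (by gcongr; exact R.le_of_opNorm_le hR x)
      calc ω * ‖y‖ ≤ r ^ (-a) * (K * r ^ a * e * (K * e * ‖x‖)) := by gcongr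
        _ = (r ^ (-a) * r ^ a) * (K * e * (K * e) * ‖x‖) := by ring
        _ = K * e * (K * e) * ‖x‖ := by
          rw [← Real.rpow_add hr0, neg_add_cancel, Real.rpow_zero, one_mul]
        _ ≤ b n * ‖x‖ := by
          gcongr
          rw [hbn]
          have : 0 ≤ K * (e * e) := by positivity
          linarith
  have hPn : ∀ {n : ℕ}, 1 ≤ n → ‖P n‖ ≤ K * (n : ℝ) ^ eps := by
    intro n hn
    have hn0 : (n : ℝ) ≠ 0 := by positivity
    have := (hD n n hn le_rfl).1
    have e : (coc A n n : E →L[ℝ] E).comp (P n) = P n := by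
      ext x
      simp [coc_self_apply]
    simpa [e, hn0] using this
  have hQn : ∀ {n : ℕ}, 1 ≤ n → ‖Q n‖ ≤ K * (n : ℝ) ^ eps := by
    intro n hn
    have hn0 : (n : ℝ) ≠ 0 := by positivity
    have := (hD n n hn le_rfl).2.1
    have e : (coc A n n : E →L[ℝ] E).comp (ContinuousLinearMap.id ℝ E - P n) = Q n := by
      ext x
      simp [coc_self_apply, hQ]
    simpa [e, hn0] using this
  have hb0 : ∀ n, 0 ≤ b n := fun n => by positivity
  have ratio : ∀ {m n : ℕ}, 1 ≤ n → n ≤ m → (1 : ℝ) ≤ (m : ℝ) / n := by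
    intro m n hn hnm
    rw [one_le_div (by positivity)]
    exact_mod_cast hnm
  have flip : ∀ (m n : ℕ) (s : ℝ), ((n : ℝ) / m) ^ s = ((m : ℝ) / n) ^ (-s) := by
    intro m n s
    rw [Real.rpow_neg (by positivity), ← Real.inv_rpow (by positivity), inv_div]
  have hvB : ∀ {n : ℕ}, 1 ≤ n → ∀ m x, v n m * ‖coc A m n (P n x)‖ ≤ b n * ‖x‖ := by
    intro n hn m x
    rcases Nat.eq_zero_or_pos m with rfl | hm
    · have : v n 0 = 0 := by simp [hv, polyWeight, hlam.ne', (hlam.trans_le hla).ne']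
      rw [this, zero_mul]
      exact mul_nonneg (hb0 n) (norm_nonneg x)
    rcases le_total n m with h | h
    · exact bound (P n) _ x (coc A m n : E →L[ℝ] E) _ _ hn (ratio hn h) rfl (hPn hn)
        (.inl ⟨min_le_left _ _, (hD m n hn h).1⟩)
    · exact bound (P n) _ x (coc A m n : E →L[ℝ] E) ((n : ℝ) / m) _ hn (ratio hm h) rfl (hPn hn)
        (.inr ⟨(min_le_right _ _).trans (flip n m a).le, (hD n m hm h).2.2.2⟩)
  have hwB : ∀ {n : ℕ}, 1 ≤ n → ∀ m x, w n m * ‖coc A m n (Q n x)‖ ≤ b n * ‖x‖ := by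
    intro n hn m x
    rcases Nat.eq_zero_or_pos m with rfl | hm
    · have : w n 0 = 0 := by simp [hw, polyWeight, hlam.ne', (hlam.trans_le hla).ne']
      rw [this, zero_mul]
      exact mul_nonneg (hb0 n) (norm_nonneg x)
    rcases le_total n m with h | h
    · exact bound (Q n) _ x (coc A m n : E →L[ℝ] E) ((m : ℝ) / n) _ hn (ratio hn h) rfl (hQn hn)
        (.inr ⟨(min_le_right _ _).trans (flip m n a).le, (hD m n hn h).2.2.1⟩)
    · exact bound (Q n) _ x (coc A m n : E →L[ℝ] E) _ _ hn (ratio hm h) rfl (hQn hn)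
        (.inl ⟨min_le_left _ _, (hD n m hm h).2.1⟩)
  have hS0 : ∀ n x, 0 ≤ S n x := fun n x => weightedSup_nonneg (hv0 n) x
  have hU0 : ∀ n x, 0 ≤ U n x := fun n x => weightedSup_nonneg (hw0 n) x
  have hlower : ∀ {n : ℕ}, 1 ≤ n → ∀ x, ‖x‖ ≤ S n x + U n x := by
    intro n hn x
    have hn0 : (n : ℝ) ≠ 0 := by positivity
    have h1 : v n n * ‖coc A n n (P n x)‖ ≤ S n x :=
      le_weightedSup (T := fun m => (coc A m n : E →L[ℝ] E).comp (P n)) (hvB hn) n x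
    have h2 : w n n * ‖coc A n n (Q n x)‖ ≤ U n x :=
      le_weightedSup (T := fun m => (coc A m n : E →L[ℝ] E).comp (Q n)) (hwB hn) n x
    simp only [hv, hw, div_self hn0, polyWeight_one, one_mul, coc_self_apply] at h1 h2
    calc ‖x‖ = ‖P n x + Q n x‖ := by simp [hQ]
      _ ≤ ‖P n x‖ + ‖Q n x‖ := norm_add_le _ _
      _ ≤ _ := add_le_add h1 h2
  have hvle : ∀ {k n : ℕ}, 1 ≤ k → 1 ≤ n → ∀ c : ℝ, ((n : ℝ) / k) ^ lam ≤ c →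
      ((n : ℝ) / k) ^ a ≤ c → ∀ m, v k m ≤ c * v n m := by
    intro k n hk hn c h1 h2 m
    have e : (m : ℝ) / k = n / k * (m / n) := by field_simp
    simp only [hv, e]
    exact polyWeight_mul_le (by positivity) (by positivity) h1 h2
  have hwle : ∀ {k n : ℕ}, 1 ≤ k → 1 ≤ n → ∀ c : ℝ, ((k : ℝ) / n) ^ lam ≤ c →
      ((k : ℝ) / n) ^ a ≤ c → ∀ m, w k m ≤ c * w n m := by
    intro k n hk hn c h1 h2 m
    have e : (k : ℝ) / m = k / n * (n / m) := by field_simp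
    simp only [hw, e]
    exact polyWeight_mul_le (by positivity) (by positivity) h1 h2
  have hSstep : ∀ {k n : ℕ}, 1 ≤ k → 1 ≤ n → ∀ c : ℝ, ((n : ℝ) / k) ^ lam ≤ c →
      ((n : ℝ) / k) ^ a ≤ c → ∀ x, S k (coc A k n x) ≤ c * S n x :=
    fun hk hn c h1 h2 => orbitSup_coc_le (hPc hk hn) ((by positivity : (0 : ℝ) ≤ _).trans h1)
      (hvB hn) (hvle hk hn c h1 h2)
  have hUstep : ∀ {k n : ℕ}, 1 ≤ k → 1 ≤ n → ∀ c : ℝ, ((k : ℝ) / n) ^ lam ≤ c →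
      ((k : ℝ) / n) ^ a ≤ c → ∀ x, U k (coc A k n x) ≤ c * U n x :=
    fun hk hn c h1 h2 => orbitSup_coc_le (hQc hk hn) ((by positivity : (0 : ℝ) ≤ _).trans h1)
      (hwB hn) (hwle hk hn c h1 h2)
  refine ⟨fun n x => S n x + U n x, fun n hn => ?_, ⟨1, lam, a, one_pos, hlam, hla, P, hPP, hAP,
    fun m n hn hnm x => ?_⟩, 2 * (K + K * K), 2 * eps, by positivity, by positivity,
    fun n hn x => ⟨hlower hn x, ?_⟩⟩
  · exact isNormOn_orbitSup_add (hv0 n) (hw0 n) (hvB hn) (hwB hn) (hlower hn)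
  · have hm : 1 ≤ m := hn.trans hnm
    have hr := ratio hn hnm
    have hr0 : (0 : ℝ) < (m : ℝ) / n := by linarith
    have hla1 : ((m : ℝ) / n) ^ lam ≤ ((m : ℝ) / n) ^ a := Real.rpow_le_rpow_of_exponent_le hr hla
    have hla2 : ((m : ℝ) / n) ^ (-a) ≤ ((m : ℝ) / n) ^ (-lam) :=
      Real.rpow_le_rpow_of_exponent_le hr (by linarith)
    have hla3 : ((m : ℝ) / n) ^ (-lam) ≤ ((m : ℝ) / n) ^ a :=
      Real.rpow_le_rpow_of_exponent_le hr (by linarith)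
    have hc0 : 0 ≤ ((m : ℝ) / n) ^ (-lam) := by positivity
    have hSd := hSstep hm hn (((m : ℝ) / n) ^ (-lam)) (flip m n lam).le ((flip m n a).le.trans hla2)
    have hSg := hSstep hn hm (((m : ℝ) / n) ^ a) hla1 le_rfl
    have hUd := hUstep hn hm (((m : ℝ) / n) ^ (-lam)) (flip m n lam).le ((flip m n a).le.trans hla2)
    have hUg := hUstep hm hn (((m : ℝ) / n) ^ a) hla1 le_rfl
    simp only [one_mul]
    refine ⟨?_, ?_, ?_, ?_⟩
    · have hU' : U m (coc A m n (P n x)) = 0 := weightedSup_eq_zero fun k => by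
        simp [hQ, hPc hm hn, hPi hn]
      have hS' : S n (P n x) = S n x := by
        simp [hS, orbitSup, weightedSup, hPi hn]
      have := hSd (P n x)
      rw [hS'] at this
      have := mul_nonneg hc0 (hU0 n x)
      rw [hU']
      linarith
    · have hS' : S n (coc A n m (x - P m x)) = 0 := weightedSup_eq_zero fun k => by
        simp [hPc hn hm, hPi hm]
      have hU' : U m (x - P m x) = U m x := by
        simp [hU, hQ, orbitSup, weightedSup, hPi hm]
      have := hUd (x - P m x)
      rw [hU'] at this
      have := mul_nonneg hc0 (hS0 m x)
      rw [hS']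
      linarith
    · have h1 := hSd x
      have h2 := hUg x
      have := mul_le_mul_of_nonneg_right hla3 (hS0 n x)
      linarith
    · have h1 := hSg x
      have h2 := hUd x
      have := mul_le_mul_of_nonneg_right hla3 (hU0 m x)
      linarith
  · have h1 : S n x ≤ b n * ‖x‖ :=
      weightedSup_le (T := fun m => (coc A m n : E →L[ℝ] E).comp (P n)) (hvB hn) x
    have h2 : U n x ≤ b n * ‖x‖ :=
      weightedSup_le (T := fun m => (coc A m n : E →L[ℝ] E).comp (Q n)) (hwB hn) x
    simp only [hb] at h1 h2
    linarith

theorem StrongPolyDichotomyWRT.nonuniform {A : ℕ → (E ≃L[ℝ] E)} {N : ℕ → E → ℝ}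
    (h : StrongPolyDichotomyWRT A N) {C δ : ℝ} (hC : 0 < C) (hδ : 0 ≤ δ)
    (hN : ∀ n : ℕ, 1 ≤ n → ∀ x : E, ‖x‖ ≤ N n x ∧ N n x ≤ C * (n : ℝ) ^ δ * ‖x‖) :
    NonuniformStrongPolyDichotomy A := by
  obtain ⟨K, lam, a, hK, hlam, hla, P, hPP, hAP, hD⟩ := h
  have key : ∀ {m n : ℕ} (T : E →L[ℝ] E) (c : ℝ), 1 ≤ m → 1 ≤ n → 0 ≤ c →
      (∀ x, N m (T x) ≤ K * c * N n x) → ‖T‖ ≤ K * C * c * (n : ℝ) ^ δ := by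
    intro m n T c hm hn hc hT
    refine T.opNorm_le_bound (by positivity) fun x => ?_
    calc ‖T x‖ ≤ K * c * N n x := (hN m hm _).1.trans (hT x)
      _ ≤ K * c * (C * (n : ℝ) ^ δ * ‖x‖) := by
        gcongr
        exact (hN n hn x).2
      _ = _ := by ring
  refine ⟨δ, hδ, K * C, lam, a, by positivity, hlam, hla, P, hPP, hAP, fun m n hn hnm => ?_⟩
  have hm : 1 ≤ m := hn.trans hnm
  exact ⟨key _ _ hm hn (by positivity) fun x => (hD m n hn hnm x).1,
    key _ _ hn hm (by positivity) fun x => (hD m n hn hnm x).2.1,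
    key _ _ hm hn (by positivity) fun x => (hD m n hn hnm x).2.2.1,
    key _ _ hn hm (by positivity) fun x => (hD m n hn hnm x).2.2.2⟩

/-- Proposition: characterization of nonuniform strong polynomial
dichotomies via sequences of norms. -/
theorem nonuniformStrongPolyDichotomy_iff_exists_norms {d : ℕ}
    (A : ℕ → (EuclideanSpace ℝ (Fin d) ≃L[ℝ] EuclideanSpace ℝ (Fin d))) :
    NonuniformStrongPolyDichotomy A ↔
      ∃ N : ℕ → EuclideanSpace ℝ (Fin d) → ℝ,
        (∀ n : ℕ, 1 ≤ n → IsNormOn (N n)) ∧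
        StrongPolyDichotomyWRT A N ∧
        ∃ C δ : ℝ, 0 < C ∧ 0 ≤ δ ∧
          ∀ (n : ℕ), 1 ≤ n → ∀ x : EuclideanSpace ℝ (Fin d),
            ‖x‖ ≤ N n x ∧ N n x ≤ C * (n : ℝ) ^ δ * ‖x‖ := by
  refine ⟨fun h => h.exists_norms, ?_⟩
  rintro ⟨N, -, hN, C, δ, hC, hδ, hb⟩
  exact hN.nonuniform hC hδ hb

end NonautLin
end
end

section
/- Let 𝔸 = (A_n)_{n∈ℤ⁺} be a sequence of invertible linear operators on ℝ^d and 𝒮 = (‖·‖_n)_{n∈ℤ⁺} a sequence of norms on ℝ^d for which there exist K,a>0 such that ‖𝒜(m,n)x‖_m ≤ Ke^{a(m-n)}‖x‖_n and ‖𝒜(n,m)x‖_n ≤ Ke^{a(m-n)}‖x‖_m for all m≥n≥0 and x∈ℝ^d. Then there exist an integer r with 1≤r≤d and real numbers a_1≤b_1<a_2≤b_2<···<a_r≤b_r (all positive) such that the exponential dichotomy spectrum satisfies Σ_{ED,𝔸,𝒮} = ⋃_{i=1}^r [a_i, b_i]. -/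
noncomputable section

namespace NonautLin

variable {E : Type*} [NormedAddCommGroup E] [NormedSpace ℝ E]

/-- Multiplication by the scalar `c` as a continuous linear equivalence
(junk value `id` for `c = 0`). -/
def smulCLE (c : ℝ) : E ≃L[ℝ] E :=
  if hc : c = 0 then ContinuousLinearEquiv.refl ℝ E
  else
    { toFun := fun x => c • x
      invFun := fun x => c⁻¹ • x
      map_add' := fun x y => smul_add c x y
      map_smul' := fun a x => smul_comm c a x
      left_inv := fun x => by simp [smul_smul, inv_mul_cancel₀ hc]
      right_inv := fun x => by simp [smul_smul, mul_inv_cancel₀ hc]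
      continuous_toFun := continuous_const_smul c
      continuous_invFun := continuous_const_smul c⁻¹ }

/-- The operator `c • A` as a continuous linear equivalence. -/
def scale (c : ℝ) (A : E ≃L[ℝ] E) : E ≃L[ℝ] E := A.trans (smulCLE c)

/-- Strong exponential dichotomy, over `ℤ⁺`, with respect to a sequence of norms and a
given sequence of projections. -/
def StrongExpDichotomyWRTProj (B : ℕ → (E ≃L[ℝ] E)) (N : ℕ → E → ℝ)
    (P : ℕ → (E →L[ℝ] E)) : Prop :=
  ∃ K lam a : ℝ, 0 < K ∧ 0 < lam ∧ lam ≤ a ∧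
    (∀ n, (P n).comp (P n) = P n) ∧
    (∀ n, ((B n : E →L[ℝ] E)).comp (P n) = (P (n + 1)).comp (B n : E →L[ℝ] E)) ∧
    (∀ m n : ℕ, n ≤ m → ∀ x : E,
      N m (coc B m n (P n x)) ≤ K * Real.exp (-lam * ((m : ℝ) - n)) * N n x ∧
      N n (coc B n m (x - P m x)) ≤ K * Real.exp (-lam * ((m : ℝ) - n)) * N m x ∧
      N m (coc B m n x) ≤ K * Real.exp (a * ((m : ℝ) - n)) * N n x ∧
      N n (coc B n m x) ≤ K * Real.exp (a * ((m : ℝ) - n)) * N m x)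

/-- Strong exponential dichotomy, over `ℤ⁺`, with respect to a sequence of norms. -/
def StrongExpDichotomyWRT (B : ℕ → (E ≃L[ℝ] E)) (N : ℕ → E → ℝ) : Prop :=
  ∃ P : ℕ → (E →L[ℝ] E), StrongExpDichotomyWRTProj B N P

/-- The exponential dichotomy spectrum over `ℤ⁺`: the set of `τ > 0` such that
`((1/τ) B_n)` does not admit a strong exponential dichotomy w.r.t. the norms `N`. -/
def SigmaED (B : ℕ → (E ≃L[ℝ] E)) (N : ℕ → E → ℝ) : Set ℝ :=
  {τ | 0 < τ ∧ ¬ StrongExpDichotomyWRT (fun n => scale τ⁻¹ (B n)) N}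

section Intervals

/-- The complement in `(0, ∞)` of finitely many ordered open intervals, the first of which
reaches `0` and the last of which reaches `∞`, is a finite disjoint union of compact intervals. -/
theorem exists_compl_eq_iUnion_Icc {d : ℕ} (hd : 1 ≤ d) (U : ℕ → Set ℝ)
    (hopen : ∀ k, IsOpen (U k)) (hconn : ∀ k, (U k).OrdConnected)
    (hpos : ∀ k, ∀ x ∈ U k, 0 < x) (hle : ∀ k, (U k).Nonempty → k ≤ d)
    (hlt : ∀ k l, k < l → ∀ x ∈ U k, ∀ y ∈ U l, x < y)
    {c C : ℝ} (hc : 0 < c) (hbot : Set.Ioo 0 c ⊆ U 0) (htop : Set.Ioi C ⊆ U d) :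
    ∃ r : ℕ, 1 ≤ r ∧ r ≤ d ∧
      ∃ aa bb : ℕ → ℝ,
        (∀ i : ℕ, 1 ≤ i → i ≤ r → 0 < aa i ∧ aa i ≤ bb i) ∧
        (∀ i : ℕ, 1 ≤ i → i < r → bb i < aa (i + 1)) ∧
        {τ : ℝ | 0 < τ ∧ ∀ k, τ ∉ U k} = ⋃ i ∈ Finset.Icc 1 r, Set.Icc (aa i) (bb i) := by
  classical
  set p : ℕ → Prop := fun k => (U k).Nonempty with hp
  have hfin : {k | p k}.Finite := (Set.finite_Iic d).subset fun k hk => hle k hk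
  have p0 : p 0 := ⟨c / 2, hbot ⟨by positivity, by linarith⟩⟩
  have pd : p d := ⟨C + 1, htop (by simp)⟩
  set s : ℕ := hfin.toFinset.card with hs
  have hs_le : s ≤ d + 1 := by
    rw [hs, ← Nat.card_Iic d]
    exact Finset.card_le_card fun k hk => by
      rw [Set.Finite.mem_toFinset] at hk
      exact Finset.mem_Iic.2 (hle k hk)
  have hs_ge : 2 ≤ s := by
    have h : ({0, d} : Finset ℕ) ⊆ hfin.toFinset := by
      intro k hk
      simp only [Finset.mem_insert, Finset.mem_singleton] at hk
      rw [Set.Finite.mem_toFinset]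
      rcases hk with rfl | rfl <;> assumption
    have := Finset.card_le_card h
    rwa [Finset.card_pair (by omega)] at this
  set V : ℕ → Set ℝ := fun i => U (Nat.nth p i) with hV
  have hVne : ∀ i < s, (V i).Nonempty := fun i hi => Nat.nth_mem_of_lt_card hfin hi
  have hVlt : ∀ i j, i < j → j < s → ∀ x ∈ V i, ∀ y ∈ V j, x < y := fun i j hij hj =>
    hlt _ _ (Nat.nth_lt_nth_of_lt_card hfin hij hj)
  have hUV : ∀ k, p k → ∃ i < s, V i = U k := fun k hk =>
    ⟨Nat.count p k, Nat.count_lt_card hfin hk, by simp [hV, Nat.nth_count hk]⟩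
  have hVopen : ∀ i, IsOpen (V i) := fun i => hopen _
  have hbdd : ∀ i, i + 1 < s → BddAbove (V i) := fun i hi => by
    obtain ⟨y, hy⟩ := hVne _ hi
    exact ⟨y, fun x hx => (hVlt i (i + 1) (by omega) hi x hx y hy).le⟩
  have hbddB : ∀ i, BddBelow (V i) := fun i => ⟨0, fun x hx => (hpos _ x hx).le⟩
  have lt_sup : ∀ i, i + 1 < s → ∀ x ∈ V i, x < sSup (V i) := fun i hi x hx => by
    obtain ⟨y, hxy, hy⟩ := Filter.nonempty_of_mem
      (Filter.inter_mem (self_mem_nhdsWithin (a := x) (s := Set.Ioi x))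
        (mem_nhdsWithin_of_mem_nhds ((hVopen i).mem_nhds hx)))
    exact lt_of_lt_of_le hxy (le_csSup (hbdd i hi) hy)
  have inf_lt : ∀ i, ∀ x ∈ V i, sInf (V i) < x := fun i x hx => by
    obtain ⟨y, hxy, hy⟩ := Filter.nonempty_of_mem
      (Filter.inter_mem (self_mem_nhdsWithin (a := x) (s := Set.Iio x))
        (mem_nhdsWithin_of_mem_nhds ((hVopen i).mem_nhds hx)))
    exact lt_of_le_of_lt (csInf_le (hbddB i) hy) hxy
  refine ⟨s - 1, by omega, by omega, fun i => sSup (V (i - 1)), fun i => sInf (V i), ?_, ?_, ?_⟩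
  · intro i h1 hi
    obtain ⟨x, hx⟩ := hVne (i - 1) (by omega)
    refine ⟨(hpos _ x hx).trans (lt_sup _ (by omega) x hx), ?_⟩
    exact csSup_le ⟨x, hx⟩ fun u hu => le_csInf (hVne i (by omega)) fun v hv =>
      (hVlt (i - 1) i (by omega) (by omega) u hu v hv).le
  · intro i h1 hi
    obtain ⟨x, hx⟩ := hVne i (by omega)
    exact (inf_lt i x hx).trans (by simpa using lt_sup i (by omega) x hx)
  · ext τ
    simp only [Set.mem_ofPred_eq, Set.mem_iUnion, Finset.mem_Icc, Set.mem_Icc, exists_prop]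
    constructor
    · rintro ⟨hτ, hnot⟩
      have hside : ∀ i, ∀ x ∈ V i, x < τ → ∀ y ∈ V i, y < τ := fun i x hx hxτ y hy => by
        by_contra! h
        exact hnot _ ((hconn _).out hx hy ⟨hxτ.le, h⟩)
      set q : ℕ → Prop := fun i => i < s ∧ ∃ x ∈ V i, x < τ with hq
      have q0 : q 0 := by
        refine ⟨by omega, min c τ / 2, ?_, ?_⟩
        · have : Nat.nth p 0 = 0 := Nat.nth_zero_of_zero p0
          simp only [hV, this]
          have := min_le_left c τ
          have : 0 < min c τ := lt_min hc hτ
          exact hbot ⟨by positivity, by linarith⟩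
        · have := min_le_right c τ
          linarith
      have hqle : ∀ i, q i → i ≤ s := fun i hi => hi.1.le
      set j := Nat.findGreatest q s with hj
      have qj : q j := Nat.findGreatest_spec (Nat.zero_le s) q0
      have hmax : ∀ i, q i → i ≤ j := fun i hi => Nat.le_findGreatest (hqle i hi) hi
      obtain ⟨hjs, x, hx, hxτ⟩ := qj
      have hj1 : j + 1 < s := by
        by_contra hcon
        obtain ⟨i, hi, hVi⟩ := hUV d pd
        have hmem : max (C + 1) (τ + 1) ∈ V i := by
          rw [hVi]
          exact htop (lt_of_lt_of_le (lt_add_one C) (le_max_left _ _))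
        have hτle := le_max_right (C + 1) (τ + 1)
        rcases (show i ≤ j by omega).lt_or_eq with h | h
        · have := hVlt i j h hjs _ hmem x hx
          linarith
        · subst h
          have := hside _ x hx hxτ _ hmem
          linarith
      refine ⟨j + 1, ⟨by omega, by omega⟩, ?_, ?_⟩
      · exact csSup_le ⟨x, hx⟩ fun y hy => (hside j x hx hxτ y hy).le
      · refine le_csInf (hVne _ hj1) fun y hy => ?_
        by_contra! h
        have := hmax (j + 1) ⟨hj1, y, hy, h⟩
        omega
    · rintro ⟨i, ⟨h1, hi⟩, hl, hr⟩
      obtain ⟨x, hx⟩ := hVne (i - 1) (by omega)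
      have hx' := lt_sup _ (by omega) x hx
      refine ⟨(hpos _ x hx).trans (hx'.trans_le hl), fun k hk => ?_⟩
      obtain ⟨j, hjs, hVj⟩ := hUV k ⟨τ, hk⟩
      rw [← hVj] at hk
      rcases lt_trichotomy j i with h | h | h
      · rcases (show j ≤ i - 1 by omega).lt_or_eq with h' | h'
        · have := hVlt j (i - 1) h' (by omega) τ hk x hx
          linarith
        · subst h'
          have := lt_sup _ (by omega) τ hk
          linarith
      · subst h
        have := inf_lt _ τ hk
        linarith
      · obtain ⟨y, hy⟩ := hVne i (by omega)
        have := inf_lt i y hy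
        have := hVlt i j h hjs y hy τ hk
        linarith

end Intervals

theorem IsNormOn.nonneg {N : E → ℝ} (hN : IsNormOn N) (x : E) : 0 ≤ N x := hN.1 x

theorem IsNormOn.eq_zero {N : E → ℝ} (hN : IsNormOn N) {x : E} (h : N x = 0) : x = 0 :=
  (hN.2.1 x).1 h

theorem IsNormOn.map_zero {N : E → ℝ} (hN : IsNormOn N) : N 0 = 0 := (hN.2.1 0).2 rfl

theorem IsNormOn.map_smul_of_pos {N : E → ℝ} (hN : IsNormOn N) {c : ℝ} (hc : 0 < c) (x : E) :
    N (c • x) = c * N x := by rw [hN.2.2.1, abs_of_pos hc]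

theorem scale_apply {c : ℝ} (hc : c ≠ 0) (A : E ≃L[ℝ] E) (x : E) : scale c A x = c • A x := by
  simp only [scale, smulCLE, dif_neg hc]
  rfl

theorem fwd_scale_apply {c : ℝ} (hc : c ≠ 0) (A : ℕ → (E ≃L[ℝ] E)) (n k : ℕ) (x : E) :
    fwd (fun i => scale c (A i)) n k x = c ^ k • fwd A n k x := by
  induction k with
  | zero => simp [fwd]
  | succ k ih =>
    simp only [fwd, ContinuousLinearEquiv.trans_apply, ih, scale_apply hc, map_smul, smul_smul,
      pow_succ']

theorem fwd_scale_symm_apply {c : ℝ} (hc : c ≠ 0) (A : ℕ → (E ≃L[ℝ] E)) (n k : ℕ) (x : E) :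
    (fwd (fun i => scale c (A i)) n k).symm x = (c⁻¹) ^ k • (fwd A n k).symm x := by
  rw [ContinuousLinearEquiv.symm_apply_eq, fwd_scale_apply hc, map_smul,
    ContinuousLinearEquiv.apply_symm_apply, smul_smul, ← mul_pow, mul_inv_cancel₀ hc, one_pow,
    one_smul]

theorem coc_add_left (A : ℕ → (E ≃L[ℝ] E)) (n k : ℕ) : coc A (n + k) n = fwd A n k := by
  simp [coc]

theorem coc_add_right (A : ℕ → (E ≃L[ℝ] E)) (n k : ℕ) :
    coc A n (n + k) = (fwd A n k).symm := by
  rcases Nat.eq_zero_or_pos k with rfl | hk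
  · simp [coc, fwd]
  · rw [coc, if_neg (by omega), Nat.add_sub_cancel_left]

/-- The projections `P` split the cocycle of `A` into a part growing at most like `α ^ k` and a
part growing at least like `β ^ k`. -/
structure IsSplitting (A : ℕ → (E ≃L[ℝ] E)) (N : ℕ → E → ℝ) (P : ℕ → (E →L[ℝ] E))
    (K α β : ℝ) : Prop where
  idem : ∀ n x, P n (P n x) = P n x
  comm : ∀ n x, A n (P n x) = P (n + 1) (A n x)
  upper : ∀ n k x, N (n + k) (fwd A n k (P n x)) ≤ K * α ^ k * N n x
  lower : ∀ n k x, β ^ k * N n (x - P n x) ≤ K * N (n + k) (fwd A n k x)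

section Splitting

variable {A : ℕ → (E ≃L[ℝ] E)} {N : ℕ → E → ℝ} {P P' : ℕ → (E →L[ℝ] E)} {K K' α β α' β' : ℝ}

theorem fwd_apply_comm (h : ∀ n x, A n (P n x) = P (n + 1) (A n x)) (n k : ℕ) (x : E) :
    fwd A n k (P n x) = P (n + k) (fwd A n k x) := by
  induction k with
  | zero => rfl
  | succ k ih =>
    simp only [fwd, ContinuousLinearEquiv.trans_apply, ih, h]
    rfl

theorem IsSplitting.range_le (hN : ∀ n, IsNormOn (N n)) (hK' : 0 < K') (hα : 0 ≤ α)
    (h : IsSplitting A N P K α β) (h' : IsSplitting A N P' K' α' β') (hαβ : α < β') :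
    (P 0 : E →ₗ[ℝ] E).range ≤ (P' 0 : E →ₗ[ℝ] E).range := by
  rintro _ ⟨y, rfl⟩
  set x : E := P 0 y with hx
  have hPx : P 0 x = x := h.idem 0 y
  have hβ : 0 < β' := hα.trans_lt hαβ
  have hbound : ∀ k : ℕ, N 0 (x - P' 0 x) ≤ K' * K * N 0 x * (α / β') ^ k := fun k => by
    have h1 := h'.lower 0 k x
    have h2 := h.upper 0 k x
    rw [hPx] at h2
    have h3 := h1.trans (mul_le_mul_of_nonneg_left h2 hK'.le)
    rw [div_pow, ← mul_div_assoc, le_div_iff₀ (pow_pos hβ k)]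
    linarith
  have hlim : Filter.Tendsto (fun k : ℕ => K' * K * N 0 x * (α / β') ^ k) Filter.atTop
      (nhds (K' * K * N 0 x * 0)) :=
    (tendsto_pow_atTop_nhds_zero_of_lt_one (by positivity)
      ((div_lt_one hβ).2 hαβ)).const_mul _
  rw [mul_zero] at hlim
  have hzero := (hN 0).eq_zero
    (le_antisymm (ge_of_tendsto' hlim hbound) ((hN 0).nonneg _))
  exact ⟨x, (sub_eq_zero.1 hzero).symm⟩

theorem IsSplitting.comp_eq (h : IsSplitting A N P K α β) (h' : IsSplitting A N P' K' α' β')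
    (hr : (P' 0 : E →ₗ[ℝ] E).range ≤ (P 0 : E →ₗ[ℝ] E).range) (n : ℕ) (x : E) :
    P n (P' n x) = P' n x := by
  induction n generalizing x with
  | zero =>
    obtain ⟨y, hy⟩ := hr ⟨x, rfl⟩
    have hy' : P 0 y = P' 0 x := hy
    rw [← hy', h.idem]
  | succ n ih =>
    obtain ⟨y, rfl⟩ := (A n).surjective x
    rw [← h'.comm, ← h.comm, ih]

/-- Two splittings with the same range combine into one with the better bounds of each. -/
theorem IsSplitting.combine (hN : ∀ n, IsNormOn (N n)) (hK : 0 < K) (hK' : 0 < K') (hα : 0 ≤ α) (h : IsSplitting A N P K α β) (h' : IsSplitting A N P' K' α' β')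
    (hr : (P' 0 : E →ₗ[ℝ] E).range ≤ (P 0 : E →ₗ[ℝ] E).range) :
    IsSplitting A N P' (K * K' + K') α β' where
  idem := h'.idem
  comm := h'.comm
  upper n k x := by
    have h1 := h.upper n k (P' n x)
    rw [h.comp_eq h' hr] at h1
    have h2 : N n (P' n x) ≤ K' * N n x := by simpa [fwd] using h'.upper n 0 x
    have h3 := mul_le_mul_of_nonneg_left h2 (by positivity : 0 ≤ K * α ^ k)
    have h4 : 0 ≤ K' * α ^ k * N n x := mul_nonneg (by positivity) ((hN n).nonneg x)
    linarith
  lower n k x := by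
    have h1 := h'.lower n k x
    have h4 : 0 ≤ K * K' * N (n + k) (fwd A n k x) :=
      mul_nonneg (by positivity) ((hN _).nonneg _)
    linarith

/-- The set of `τ > 0` lying in the spectral gap of a splitting of rank `k`. -/
def gapSet (A : ℕ → (E ≃L[ℝ] E)) (N : ℕ → E → ℝ) (k : ℕ) : Set ℝ :=
  {τ | ∃ (P : ℕ → (E →L[ℝ] E)) (K α β : ℝ), 0 < K ∧ 0 < α ∧ α < τ ∧ τ < β ∧
    IsSplitting A N P K α β ∧ Module.finrank ℝ (P 0 : E →ₗ[ℝ] E).range = k}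

theorem pos_of_mem_gapSet {k : ℕ} {τ : ℝ} (h : τ ∈ gapSet A N k) : 0 < τ := by
  obtain ⟨P, K, α, β, -, hα, hτ, -⟩ := h
  exact hα.trans hτ

theorem isOpen_gapSet (k : ℕ) : IsOpen (gapSet A N k) := by
  rw [isOpen_iff_mem_nhds]
  rintro τ ⟨P, K, α, β, hK, hα, hατ, hτβ, h, hk⟩
  filter_upwards [Ioo_mem_nhds hατ hτβ] with σ hσ
  exact ⟨P, K, α, β, hK, hα, hσ.1, hσ.2, h, hk⟩

theorem ordConnected_gapSet [FiniteDimensional ℝ E] (hN : ∀ n, IsNormOn (N n)) (k : ℕ) :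
    (gapSet A N k).OrdConnected := by
  refine ⟨?_⟩
  rintro τ₁ ⟨P₁, K₁, α₁, β₁, hK₁, hα₁, hατ₁, hτβ₁, h₁, hk₁⟩
    τ₂ ⟨P₂, K₂, α₂, β₂, hK₂, hα₂, hατ₂, hτβ₂, h₂, hk₂⟩ τ ⟨hl, hr⟩
  have hle := h₁.range_le hN hK₂ hα₁.le h₂ (by linarith)
  have heq := Submodule.eq_of_le_of_finrank_eq hle (hk₁.trans hk₂.symm)
  exact ⟨P₂, K₁ * K₂ + K₂, α₁, β₂, by positivity, hα₁, by linarith, by linarith,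
    h₁.combine hN hK₁ hK₂ hα₁.le h₂ heq.ge, hk₂⟩

theorem lt_of_mem_gapSet [FiniteDimensional ℝ E] (hN : ∀ n, IsNormOn (N n)) {k l : ℕ}
    (hkl : k < l) {x y : ℝ} (hx : x ∈ gapSet A N k) (hy : y ∈ gapSet A N l) : x < y := by
  obtain ⟨P₁, K₁, α₁, β₁, hK₁, hα₁, hατ₁, hτβ₁, h₁, hk₁⟩ := hx
  obtain ⟨P₂, K₂, α₂, β₂, hK₂, hα₂, hατ₂, hτβ₂, h₂, hk₂⟩ := hy
  by_contra! hyx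
  have hle := h₂.range_le hN hK₁ hα₂.le h₁ (by linarith)
  have := Submodule.finrank_mono hle
  omega

theorem le_finrank_of_mem_gapSet [FiniteDimensional ℝ E] {k : ℕ} {x : ℝ}
    (hx : x ∈ gapSet A N k) : k ≤ Module.finrank ℝ E := by
  obtain ⟨P, -, -, -, -, -, -, -, -, rfl⟩ := hx
  exact Submodule.finrank_le _

theorem Ioo_subset_gapSet_zero (hN : ∀ n, IsNormOn (N n)) (hK : 0 < K)
    (hlow : ∀ n k x, β ^ k * N n x ≤ K * N (n + k) (fwd A n k x)) :
    Set.Ioo 0 β ⊆ gapSet A N 0 := by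
  rintro τ ⟨h0, hτ⟩
  refine ⟨fun _ => 0, K, τ / 2, β, hK, by linarith, by linarith, hτ, ⟨?_, ?_, ?_, ?_⟩, ?_⟩
  · simp
  · simp
  · intro n k x
    have := (hN n).nonneg x
    simp only [zero_apply, map_zero, (hN _).map_zero]
    positivity
  · simpa using hlow
  · exact (congrArg (fun S : Submodule ℝ E => Module.finrank ℝ S) LinearMap.range_zero).trans
      (finrank_bot ℝ E)

theorem Ioi_subset_gapSet_finrank (hN : ∀ n, IsNormOn (N n)) (hK : 0 < K) (hα : 0 < α)
    (hup : ∀ n k x, N (n + k) (fwd A n k x) ≤ K * α ^ k * N n x) :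
    Set.Ioi α ⊆ gapSet A N (Module.finrank ℝ E) := by
  intro τ hτ
  refine ⟨fun _ => ContinuousLinearMap.id ℝ E, K, α, τ + 1, hK, hα, hτ, by linarith,
    ⟨?_, ?_, ?_, ?_⟩, ?_⟩
  · simp
  · simp
  · simpa using hup
  · intro n k x
    have := (hN (n + k)).nonneg (fwd A n k x)
    simp only [ContinuousLinearMap.id_apply, sub_self, (hN _).map_zero, mul_zero]
    positivity
  · exact (congrArg (fun S : Submodule ℝ E => Module.finrank ℝ S) LinearMap.range_id).trans
      (finrank_top ℝ E)

theorem StrongExpDichotomyWRTProj.exists_isSplitting (hN : ∀ n, IsNormOn (N n)) {τ : ℝ}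
    (hτ : 0 < τ) (h : StrongExpDichotomyWRTProj (fun n => scale τ⁻¹ (A n)) N P) :
    ∃ K α β : ℝ, 0 < K ∧ 0 < α ∧ α < τ ∧ τ < β ∧ IsSplitting A N P K α β := by
  obtain ⟨K, lam, a, hK, hlam, -, hidem, hcomm, hb⟩ := h
  have hτ' : τ⁻¹ ≠ 0 := inv_ne_zero hτ.ne'
  have hcomm' : ∀ n x, A n (P n x) = P (n + 1) (A n x) := fun n x => by
    have := DFunLike.congr_fun (hcomm n) x
    simp only [ContinuousLinearMap.comp_apply, ContinuousLinearEquiv.coe_coe, scale_apply hτ',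
      map_smul] at this
    exact smul_right_injective E hτ' this
  have hexp : ∀ n k : ℕ, Real.exp (-lam * (((n + k : ℕ) : ℝ) - n)) = Real.exp (-lam) ^ k :=
    fun n k => by
      rw [← Real.exp_nat_mul]
      push_cast
      ring_nf
  refine ⟨K, τ * Real.exp (-lam), τ * Real.exp lam, hK, by positivity,
    mul_lt_of_lt_one_right hτ (by simpa using hlam), lt_mul_of_one_lt_right hτ (by simpa using hlam),
    ⟨fun n x => DFunLike.congr_fun (hidem n) x, hcomm', fun n k x => ?_, fun n k x => ?_⟩⟩
  · have h1 := (hb (n + k) n (by omega) x).1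
    rw [coc_add_left, fwd_scale_apply hτ', (hN _).map_smul_of_pos (by positivity), hexp,
      inv_pow, inv_mul_le_iff₀ (by positivity)] at h1
    rw [mul_pow]
    linarith
  · have h1 := (hb (n + k) n (by omega) (fwd A n k x)).2.1
    rw [coc_add_right, fwd_scale_symm_apply hτ', (hN _).map_smul_of_pos (by positivity), hexp,
      ← fwd_apply_comm hcomm', ← map_sub, ContinuousLinearEquiv.symm_apply_apply, inv_inv,
      Real.exp_neg, inv_pow] at h1
    have h2 := mul_le_mul_of_nonneg_left h1 (by positivity : 0 ≤ Real.exp lam ^ k)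
    have h3 : Real.exp lam ^ k * (Real.exp lam ^ k)⁻¹ = 1 := mul_inv_cancel₀ (by positivity)
    rw [mul_pow]
    calc τ ^ k * Real.exp lam ^ k * N n (x - P n x)
        = Real.exp lam ^ k * (τ ^ k * N n (x - P n x)) := by ring
      _ ≤ Real.exp lam ^ k * (K * (Real.exp lam ^ k)⁻¹ * N (n + k) (fwd A n k x)) := h2
      _ = Real.exp lam ^ k * (Real.exp lam ^ k)⁻¹ * (K * N (n + k) (fwd A n k x)) := by ring
      _ = K * N (n + k) (fwd A n k x) := by rw [h3, one_mul]

theorem IsSplitting.strongExpDichotomyWRTProj (hN : ∀ n, IsNormOn (N n)) {τ K₀ a : ℝ}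
    (hK : 0 < K) (hα : 0 < α) (hατ : α < τ) (hτβ : τ < β) (h : IsSplitting A N P K α β)
    (hup : ∀ n k x, N (n + k) (fwd A n k x) ≤ K₀ * Real.exp a ^ k * N n x)
    (hinv : ∀ n k x, N n ((fwd A n k).symm x) ≤ K₀ * Real.exp a ^ k * N (n + k) x) :
    StrongExpDichotomyWRTProj (fun n => scale τ⁻¹ (A n)) N P := by
  have hτ : 0 < τ := hα.trans hατ
  have hβ : 0 < β := hτ.trans hτβ
  have hτ' : τ⁻¹ ≠ 0 := inv_ne_zero hτ.ne'
  set lam : ℝ := min (Real.log (τ / α)) (Real.log (β / τ)) with hlam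
  have hlam_pos : 0 < lam := lt_min (Real.log_pos ((one_lt_div hα).2 hατ))
    (Real.log_pos ((one_lt_div hτ).2 hτβ))
  set b : ℝ := max lam (a + |Real.log τ|) with hb
  have hexp : ∀ (c : ℝ) (n k : ℕ),
      Real.exp (c * (((n + k : ℕ) : ℝ) - n)) = Real.exp c ^ k := fun c n k => by
    rw [← Real.exp_nat_mul]
    push_cast
    ring_nf
  have hα_le : τ⁻¹ * α ≤ Real.exp (-lam) := by
    rw [Real.exp_neg, le_inv_comm₀ (by positivity) (Real.exp_pos _), mul_inv, inv_inv,
      ← div_eq_mul_inv, ← Real.exp_log (show 0 < τ / α by positivity)]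
    exact Real.exp_le_exp.2 (min_le_left _ _)
  have hβ_le : τ * Real.exp lam ≤ β := by
    rw [mul_comm, ← le_div_iff₀ hτ, ← Real.exp_log (show 0 < β / τ by positivity)]
    exact Real.exp_le_exp.2 (min_le_right _ _)
  have hup_le : τ⁻¹ * Real.exp a ≤ Real.exp b := by
    rw [← Real.exp_log (inv_pos.2 hτ), ← Real.exp_add, Real.log_inv]
    exact Real.exp_le_exp.2 (le_max_of_le_right (by linarith [neg_abs_le (Real.log τ)]))
  have hinv_le : τ * Real.exp a ≤ Real.exp b := by
    nth_rw 1 [← Real.exp_log hτ]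
    rw [← Real.exp_add]
    exact Real.exp_le_exp.2 (le_max_of_le_right (by linarith [le_abs_self (Real.log τ)]))
  have hKK₀ : 0 < max K K₀ := lt_max_of_lt_left hK
  have key : ∀ (u v L s y : ℝ) (k : ℕ), 0 < u → 0 < v → u * v ≤ s → L ≤ max K K₀ → 0 ≤ y →
      u ^ k * (L * v ^ k * y) ≤ max K K₀ * s ^ k * y := fun u v L s y k hu hv hs hL hy => by
    calc u ^ k * (L * v ^ k * y) = L * (u * v) ^ k * y := by rw [mul_pow]; ring
      _ ≤ max K K₀ * s ^ k * y := by gcongr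
  refine ⟨max K K₀, lam, b, hKK₀, hlam_pos, le_max_left _ _,
    fun n => ContinuousLinearMap.ext (h.idem n), fun n => ContinuousLinearMap.ext fun x => ?_, ?_⟩
  · simp only [ContinuousLinearMap.comp_apply, ContinuousLinearEquiv.coe_coe, scale_apply hτ',
      map_smul, h.comm]
  · intro m n hnm x
    obtain ⟨k, rfl⟩ := Nat.exists_eq_add_of_le hnm
    have hNn := (hN n).nonneg x
    have hNk := (hN (n + k)).nonneg x
    have hτk : 0 < τ⁻¹ ^ k := by positivity
    simp only [coc_add_left, coc_add_right, fwd_scale_apply hτ', fwd_scale_symm_apply hτ', inv_inv,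
      hexp, (hN _).map_smul_of_pos hτk, (hN _).map_smul_of_pos (pow_pos hτ k)]
    refine ⟨?_, ?_, ?_, ?_⟩
    · exact (mul_le_mul_of_nonneg_left (h.upper n k x) hτk.le).trans
        (key _ _ _ _ _ k (inv_pos.2 hτ) hα hα_le (le_max_left _ _) hNn)
    · obtain ⟨y, rfl⟩ := (fwd A n k).surjective x
      rw [← fwd_apply_comm h.comm, ← map_sub, ContinuousLinearEquiv.symm_apply_apply]
      have h1 := h.lower n k y
      rw [mul_comm, ← le_div_iff₀ (pow_pos hβ k)] at h1
      have h2 : τ * β⁻¹ ≤ Real.exp (-lam) := by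
        rw [Real.exp_neg, ← div_eq_mul_inv, div_le_iff₀ hβ, ← div_eq_inv_mul,
          le_div_iff₀ (Real.exp_pos _)]
        exact hβ_le
      refine (mul_le_mul_of_nonneg_left (h1.trans_eq ?_) (pow_pos hτ k).le).trans
        (key τ β⁻¹ K _ _ k hτ (inv_pos.2 hβ) h2 (le_max_left _ _) hNk)
      rw [inv_pow]
      ring
    · exact (mul_le_mul_of_nonneg_left (hup n k x) hτk.le).trans
        (key _ _ _ _ _ k (inv_pos.2 hτ) (Real.exp_pos a) hup_le (le_max_right _ _) hNn)
    · exact (mul_le_mul_of_nonneg_left (hinv n k x) (pow_pos hτ k).le).trans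
        (key _ _ _ _ _ k hτ (Real.exp_pos a) hinv_le (le_max_right _ _) hNk)

theorem sigmaED_eq_compl_gapSet (hN : ∀ n, IsNormOn (N n)) {K₀ a : ℝ}
    (hup : ∀ n k x, N (n + k) (fwd A n k x) ≤ K₀ * Real.exp a ^ k * N n x)
    (hinv : ∀ n k x, N n ((fwd A n k).symm x) ≤ K₀ * Real.exp a ^ k * N (n + k) x) :
    SigmaED A N = {τ | 0 < τ ∧ ∀ k, τ ∉ gapSet A N k} := by
  ext τ
  refine and_congr_right fun hτ => ?_
  rw [← not_exists, not_iff_not]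
  constructor
  · rintro ⟨P, hP⟩
    obtain ⟨K, α, β, hK, hα, hατ, hτβ, h⟩ := hP.exists_isSplitting hN hτ
    exact ⟨_, P, K, α, β, hK, hα, hατ, hτβ, h, rfl⟩
  · rintro ⟨k, P, K, α, β, hK, hα, hατ, hτβ, h, -⟩
    exact ⟨P, h.strongExpDichotomyWRTProj hN hK hα hατ hτβ hup hinv⟩

end Splitting

/-- Proposition: structure of the exponential dichotomy spectrum. -/
theorem sigmaED_eq_iUnion_Icc {d : ℕ} (hd : 1 ≤ d)
    (A : ℕ → (EuclideanSpace ℝ (Fin d) ≃L[ℝ] EuclideanSpace ℝ (Fin d)))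
    (N : ℕ → EuclideanSpace ℝ (Fin d) → ℝ)
    (hN : ∀ n : ℕ, IsNormOn (N n))
    (K a : ℝ) (hK : 0 < K) (ha : 0 < a)
    (hbg : ∀ m n : ℕ, n ≤ m → ∀ x : EuclideanSpace ℝ (Fin d),
      N m (coc A m n x) ≤ K * Real.exp (a * ((m : ℝ) - n)) * N n x ∧
      N n (coc A n m x) ≤ K * Real.exp (a * ((m : ℝ) - n)) * N m x) :
    ∃ r : ℕ, 1 ≤ r ∧ r ≤ d ∧
      ∃ aa bb : ℕ → ℝ,
        (∀ i : ℕ, 1 ≤ i → i ≤ r → 0 < aa i ∧ aa i ≤ bb i) ∧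
        (∀ i : ℕ, 1 ≤ i → i < r → bb i < aa (i + 1)) ∧
        SigmaED A N = ⋃ i ∈ Finset.Icc 1 r, Set.Icc (aa i) (bb i) := by
  have hexp : ∀ n k : ℕ, Real.exp (a * (((n + k : ℕ) : ℝ) - n)) = Real.exp a ^ k := fun n k => by
    rw [← Real.exp_nat_mul]
    push_cast
    ring_nf
  have hup : ∀ n k x, N (n + k) (fwd A n k x) ≤ K * Real.exp a ^ k * N n x := fun n k x => by
    simpa only [coc_add_left, hexp] using (hbg (n + k) n (by omega) x).1
  have hinv : ∀ n k x, N n ((fwd A n k).symm x) ≤ K * Real.exp a ^ k * N (n + k) x :=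
    fun n k x => by
      simpa only [coc_add_right, hexp] using (hbg (n + k) n (by omega) x).2
  have hlow : ∀ n k x, (Real.exp a)⁻¹ ^ k * N n x ≤ K * N (n + k) (fwd A n k x) :=
    fun n k x => by
      have h := hinv n k (fwd A n k x)
      rw [ContinuousLinearEquiv.symm_apply_apply] at h
      rw [inv_pow, inv_mul_le_iff₀ (by positivity)]
      linarith
  have hfr : Module.finrank ℝ (EuclideanSpace ℝ (Fin d)) = d := by simp
  rw [sigmaED_eq_compl_gapSet hN hup hinv]
  exact exists_compl_eq_iUnion_Icc hd (gapSet A N) isOpen_gapSet (ordConnected_gapSet hN)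
    (fun _ _ => pos_of_mem_gapSet) (fun _ ⟨_, hx⟩ => hfr ▸ le_finrank_of_mem_gapSet hx)
    (fun _ _ hkl _ hx _ hy => lt_of_mem_gapSet hN hkl hx hy) (inv_pos.2 (Real.exp_pos a))
    (Ioo_subset_gapSet_zero hN hK hlow)
    (hfr ▸ Ioi_subset_gapSet_finrank hN hK (Real.exp_pos a) hup)

end NonautLin
end
end
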